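/- arXiv:1704.07667 — 5 statements merged into one kernel-verified Lean document; each statement's English description precedes it below -/
import Mathlib

section
/- Let p be a prime with p ≡ 1 (mod 16). With the cyclotomic classes D_0, …, D_7 of order 8 modulo p, define the quaternary sequence u : ℤ/pℤ → ℤ/4ℤ by u(t) = 0 if t ∈ D_2 ∪ D_6 ∪ {0}, u(t) = 1 if t ∈ D_1 ∪ D_3, u(t) = 2 if t ∈ D_0 ∪ D_4, and u(t) = 3 if t ∈ D_5 ∪ D_7. Then for every shift τ the autocorrelation value R_u(τ) is a real number (its imaginary part vanishes). -/
open scoped Classical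

noncomputable section

/-- The cyclotomic class `D_k` of order `e` modulo `p`, with respect to the
primitive root `γ`: `D_k = {γ^(k+e*j) : 0 ≤ j < (p-1)/e}`. -/
def cycCl (p : ℕ) (γ : ZMod p) (e k : ℕ) : Set (ZMod p) :=
  {x | ∃ j : ℕ, j < (p - 1) / e ∧ x = γ ^ (k + e * j)}

/-- Periodic autocorrelation of a quaternary sequence `u : ℤ/N → ℤ/4` at shift `τ`:
`R_u(τ) = Σ_t i^(u(t) - u(t+τ))`. -/
def quatAC {N : ℕ} [NeZero N] (u : ZMod N → ZMod 4) (τ : ZMod N) : ℂ :=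
  ∑ t : ZMod N, Complex.I ^ (u t - u (t + τ)).val

/-- Periodic crosscorrelation of binary sequences `s₁ s₂ : ℤ/N → ℤ/2` at shift `τ`:
`R_{s₁,s₂}(τ) = Σ_t (-1)^(s₁(t) - s₂(t+τ))`. -/
def binCC {N : ℕ} [NeZero N] (s₁ s₂ : ZMod N → ZMod 2) (τ : ZMod N) : ℤ :=
  ∑ t : ZMod N, (-1 : ℤ) ^ (s₁ t - s₂ (t + τ)).val

/-- The inverse Gray map `φ⁻¹ : ℤ/2 × ℤ/2 → ℤ/4`,
`φ⁻¹(0,0)=0, φ⁻¹(0,1)=1, φ⁻¹(1,1)=2, φ⁻¹(1,0)=3`. -/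
def grayInv (a b : ZMod 2) : ZMod 4 :=
  if a = 0 then (if b = 0 then 0 else 1) else (if b = 0 then 3 else 2)

/-- Characteristic (binary) sequence of a subset `C ⊆ ℤ/p`. -/
def charSeq {p : ℕ} (C : Set (ZMod p)) (t : ZMod p) : ZMod 2 :=
  if t ∈ C then 1 else 0

/-- `N_k(u)`: the number of `t` with `u(t) = k`. -/
def cnt {N m : ℕ} (u : ZMod N → ZMod m) (k : ZMod m) : ℕ :=
  {t | u t = k}.ncard

theorem pow_mem_cycCl {p : ℕ} {γ : ZMod p} (hp : 1 < p) (hγ : orderOf γ = p - 1) {e : ℕ}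
    (he : e ∣ p - 1) (n : ℕ) : γ ^ n ∈ cycCl p γ e (n % e) := by
  have hn : n % (p - 1) < p - 1 := Nat.mod_lt _ (by omega)
  refine ⟨n % (p - 1) / e, Nat.div_lt_div_of_lt_of_dvd he hn, ?_⟩
  rw [← Nat.mod_mod_of_dvd n he, Nat.mod_add_div, ← hγ, pow_mod_orderOf]

theorem pow_half_eq_neg_one {p : ℕ} [Fact p.Prime] {γ : ZMod p} (hp : p % 2 = 1)
    (hγ : orderOf γ = p - 1) : γ ^ ((p - 1) / 2) = -1 := by
  have h1 := (Fact.out : p.Prime).one_lt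
  have hsq : (γ ^ ((p - 1) / 2)) ^ 2 = 1 := by
    rw [← pow_mul, Nat.div_mul_cancel (by omega), ← hγ, pow_orderOf_eq_one]
  refine (mul_self_eq_one_iff.mp ((sq _).symm.trans hsq)).resolve_left fun h => ?_
  have := Nat.le_of_dvd (by omega) (orderOf_dvd_of_pow_eq_one h)
  omega

theorem exists_pow_eq_of_ne_zero {p : ℕ} [Fact p.Prime] {γ : ZMod p}
    (hγ : orderOf γ = p - 1) {t : ZMod p} (ht : t ≠ 0) : ∃ n : ℕ, γ ^ n = t := by
  have h1 := (Fact.out : p.Prime).one_lt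
  have : NeZero (p - 1) := ⟨by omega⟩
  have hprim : IsPrimitiveRoot γ (p - 1) := hγ ▸ IsPrimitiveRoot.orderOf γ
  obtain ⟨n, -, hn⟩ := hprim.eq_pow_of_pow_eq_one (ZMod.pow_card_sub_one_eq_one ht)
  exact ⟨n, hn⟩

theorem I_pow_val_neg_im (x : ZMod 4) :
    (Complex.I ^ (-x).val).im = -(Complex.I ^ x.val).im := by
  have h2 : (-2 : ZMod 4) = 2 := by decide
  have h1 : (-1 : ZMod 4) = 3 := by decide
  have h3 : (-3 : ZMod 4) = 1 := by decide
  have v1 : (1 : ZMod 4).val = 1 := by decide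
  have v2 : (2 : ZMod 4).val = 2 := by decide
  have v3 : (3 : ZMod 4).val = 3 := by decide
  have hx : x = 0 ∨ x = 1 ∨ x = 2 ∨ x = 3 := by revert x; decide
  rcases hx with rfl | rfl | rfl | rfl <;>
    simp [h1, h2, h3, v1, v2, v3, Complex.I_pow_three]

/-- The autocorrelation of an even quaternary sequence is real. -/
theorem quatAC_im_eq_zero_of_even {N : ℕ} [NeZero N] {u : ZMod N → ZMod 4}
    (hu : ∀ t, u (-t) = u t) (τ : ZMod N) : (quatAC u τ).im = 0 := by
  have key : (quatAC u τ).im = -(quatAC u τ).im := by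
    unfold quatAC
    rw [Complex.im_sum, ← Finset.sum_neg_distrib]
    refine Fintype.sum_equiv (Equiv.subLeft (-τ)) _ _ fun t => ?_
    have e1 : -τ - t = -(t + τ) := by ring
    have e2 : -(t + τ) + τ = -t := by ring
    rw [Equiv.subLeft_apply, e1, e2, hu, hu, ← I_pow_val_neg_im, neg_sub]
  linarith

theorem stmt2 (p : ℕ) [Fact p.Prime] (hp : p % 16 = 1)
    (γ : ZMod p) (hγ : orderOf γ = p - 1)
    (u : ZMod p → ZMod 4)
    (hu0 : ∀ t, t ∈ cycCl p γ 8 2 ∪ cycCl p γ 8 6 ∪ {0} → u t = 0)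
    (hu1 : ∀ t, t ∈ cycCl p γ 8 1 ∪ cycCl p γ 8 3 → u t = 1)
    (hu2 : ∀ t, t ∈ cycCl p γ 8 0 ∪ cycCl p γ 8 4 → u t = 2)
    (hu3 : ∀ t, t ∈ cycCl p γ 8 5 ∪ cycCl p γ 8 7 → u t = 3) :
    ∀ τ : ZMod p, (quatAC u τ).im = 0 := by
  have h1 := (Fact.out : p.Prime).one_lt
  refine quatAC_im_eq_zero_of_even fun t => ?_
  rcases eq_or_ne t 0 with rfl | ht
  · rw [neg_zero]
  obtain ⟨n, rfl⟩ := exists_pow_eq_of_ne_zero hγ ht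
  have hmem := pow_mem_cycCl h1 hγ (e := 8) (by omega) n
  have hneg : -γ ^ n ∈ cycCl p γ 8 (n % 8) := by
    have h := pow_mem_cycCl h1 hγ (e := 8) (by omega) (n + (p - 1) / 2)
    rwa [pow_add, pow_half_eq_neg_one (by omega) hγ, mul_neg_one,
      show (n + (p - 1) / 2) % 8 = n % 8 by omega] at h
  have hlt : n % 8 < 8 := Nat.mod_lt _ (by norm_num)
  generalize n % 8 = k at hmem hneg hlt
  interval_cases k
  · rw [hu2 _ (.inl hneg), hu2 _ (.inl hmem)]
  · rw [hu1 _ (.inl hneg), hu1 _ (.inl hmem)]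
  · rw [hu0 _ (.inl (.inl hneg)), hu0 _ (.inl (.inl hmem))]
  · rw [hu1 _ (.inr hneg), hu1 _ (.inr hmem)]
  · rw [hu2 _ (.inr hneg), hu2 _ (.inr hmem)]
  · rw [hu3 _ (.inl hneg), hu3 _ (.inl hmem)]
  · rw [hu0 _ (.inl (.inr hneg)), hu0 _ (.inl (.inr hmem))]
  · rw [hu3 _ (.inr hneg), hu3 _ (.inr hmem)]
end
end

section
/- Let p ≡ 1 (mod 8) be a prime, let D_0, D_1, D_2, D_3 be the cyclotomic classes of order 4 modulo p, set C_0 = D_1 ∪ D_2 and C_1 = D_2 ∪ D_3 ∪ {0}, and define the quaternary sequence u : ℤ/pℤ → ℤ/4ℤ by u(t) = φ⁻¹(s_{C_0}(t), s_{C_1}(t)). Then R_u(0) = p, and among the shifts τ = 1, …, p−1 the autocorrelation value R_u(τ) equals −1 for exactly (p−1)/2 values of τ, equals 1 for exactly (p−1)/4 values of τ, and equals −3 for exactly (p−1)/4 values of τ. -/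
open scoped Classical

noncomputable section

theorem charSeq_eq_one {p : ℕ} {C : Set (ZMod p)} {t : ZMod p} (h : t ∈ C) : charSeq C t = 1 :=
  if_pos h

theorem charSeq_eq_zero {p : ℕ} {C : Set (ZMod p)} {t : ZMod p} (h : t ∉ C) : charSeq C t = 0 :=
  if_neg h

theorem I_pow_val_sub (a b : ZMod 4) :
    Complex.I ^ (a - b).val = Complex.I ^ a.val * (starRingEnd ℂ) (Complex.I ^ b.val) := by
  have h : (a - b).val = (a.val + 3 * b.val) % 4 := by revert a b; decide
  have hI : (starRingEnd ℂ) Complex.I = Complex.I ^ 3 := by simp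
  rw [h, ← pow_eq_pow_mod _ Complex.I_pow_four, pow_add, pow_mul, map_pow, hI]

theorem ne_zero_of_orderOf_eq {p : ℕ} [Fact p.Prime] {γ : ZMod p} (hγ : orderOf γ = p - 1) :
    γ ≠ 0 := by
  have := (Fact.out : p.Prime).two_le
  rintro rfl
  rw [orderOf_zero] at hγ
  omega

theorem mem_zpowers_mk0 {p : ℕ} [Fact p.Prime] {γ : ZMod p} (hγ : orderOf γ = p - 1)
    (h0 : γ ≠ 0) (x : (ZMod p)ˣ) : x ∈ Subgroup.zpowers (Units.mk0 γ h0) := by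
  have h : Subgroup.zpowers (Units.mk0 γ h0) = ⊤ := Subgroup.eq_top_of_card_eq _ <| by
    rw [Nat.card_zpowers, ← orderOf_units, Units.val_mk0, hγ, Nat.card_eq_fintype_card,
      ZMod.card_units]
  exact h ▸ Subgroup.mem_top x

theorem exists_pow_eq {p : ℕ} [Fact p.Prime] {γ : ZMod p} (hγ : orderOf γ = p - 1)
    {t : ZMod p} (ht : t ≠ 0) : ∃ n < p - 1, t = γ ^ n := by
  have h0 := ne_zero_of_orderOf_eq hγ
  have h := mem_zpowers_mk0 hγ h0 (Units.mk0 t ht)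
  rw [mem_zpowers_iff_mem_range_orderOf] at h
  obtain ⟨n, hn, h⟩ := Finset.mem_image.1 h
  rw [Finset.mem_range, ← orderOf_units, Units.val_mk0, hγ] at hn
  exact ⟨n, hn, by simpa using (congrArg Units.val h).symm⟩

theorem pow_mem_cycCl_iff {p : ℕ} {γ : ZMod p} (hγ : orderOf γ = p - 1) (hp : p % 8 = 1)
    {n k : ℕ} (hn : n < p - 1) (hk : k < 4) : γ ^ n ∈ cycCl p γ 4 k ↔ n % 4 = k := by
  constructor
  · rintro ⟨j, hj, h⟩
    have := pow_injOn_Iio_orderOf (x := γ) (by simp; omega) (by simp; omega) h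
    omega
  · rintro rfl
    exact ⟨n / 4, by omega, by rw [Nat.mod_add_div]⟩

theorem zero_notMem_cycCl {p : ℕ} [Fact p.Prime] {γ : ZMod p} (h0 : γ ≠ 0) (e k : ℕ) :
    (0 : ZMod p) ∉ cycCl p γ e k := by
  rintro ⟨j, -, h⟩
  exact pow_ne_zero _ h0 h.symm

theorem neg_I_pow (n : ℕ) : (-Complex.I) ^ n = (-Complex.I) ^ (n % 4) := by
  have h : (-Complex.I) ^ 4 = 1 := by rw [neg_pow, Complex.I_pow_four]; norm_num
  exact pow_eq_pow_mod n h

theorem exists_mulChar {p : ℕ} [Fact p.Prime] (hp : p % 8 = 1)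
    {γ : ZMod p} (hγ : orderOf γ = p - 1) :
    ∃ χ : MulChar (ZMod p) ℂ, χ γ = -Complex.I := by
  have h0 := ne_zero_of_orderOf_eq hγ
  have hμ : Units.mk0 (-Complex.I) (by simp) ∈ rootsOfUnity (Fintype.card (ZMod p)ˣ) ℂ := by
    rw [mem_rootsOfUnity', Units.val_mk0, neg_I_pow, ZMod.card_units,
      show (p - 1) % 4 = 0 by omega, pow_zero]
  exact ⟨MulChar.ofRootOfUnity hμ (g := Units.mk0 γ h0)
      (mem_zpowers_mk0 hγ h0),
    MulChar.ofRootOfUnity_spec hμ _⟩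

theorem sum_mulChar_mul_inv_add {F R : Type*} [Field F] [Fintype F] [DecidableEq F] [CommRing R]
    [IsDomain R] {χ : MulChar F R} (hχ : χ ≠ 1) {τ : F} (hτ : τ ≠ 0) :
    ∑ t, χ t * χ⁻¹ (t + τ) = -1 := by
  have h := jacobiSum_nontrivial_inv hχ
  rw [jacobiSum] at h
  have h1 : ∀ x, χ (-τ * x) * χ⁻¹ (-τ * x + τ) = χ (-1) * (χ x * χ⁻¹ (1 - x)) := by
    intro x
    have h2 : χ τ * χ⁻¹ τ = 1 := by
      rw [← MulChar.mul_apply, mul_inv_cancel, MulChar.one_apply hτ.isUnit]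
    rw [show -τ * x + τ = τ * (1 - x) by ring, show -τ * x = -1 * (τ * x) by ring, map_mul, map_mul,
      map_mul]
    linear_combination χ (-1) * χ x * χ⁻¹ (1 - x) * h2
  rw [← Equiv.sum_comp (Equiv.mulLeft₀ (-τ) (neg_ne_zero.2 hτ))]
  simp only [Equiv.mulLeft₀_apply, h1]
  rw [← Finset.mul_sum, h, mul_neg, ← map_mul]
  simp

theorem ncard_pow_progression {p : ℕ} {γ : ZMod p} (hγ : orderOf γ = p - 1) {a b m : ℕ}
    (hb : 0 < b) (h : ∀ j < m, a + b * j < p - 1) :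
    {x | ∃ j < m, x = γ ^ (a + b * j)}.ncard = m := by
  have : {x | ∃ j < m, x = γ ^ (a + b * j)} = (fun j => γ ^ (a + b * j)) '' (Set.Iio m) := by
    ext x; simp [eq_comm]
  rw [this, Set.InjOn.ncard_image]
  · simp
  · intro i hi j hj hij
    have := pow_injOn_Iio_orderOf (x := γ) (by simpa [hγ] using h i hi)
      (by simpa [hγ] using h j hj) hij
    exact Nat.eq_of_mul_eq_mul_left hb (by omega)

theorem I_pow_grayInv {p : ℕ} [Fact p.Prime] (hp : p % 8 = 1)
    {γ : ZMod p} (hγ : orderOf γ = p - 1) {χ : MulChar (ZMod p) ℂ} (hχ : χ γ = -Complex.I)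
    (t : ZMod p) :
    Complex.I ^ (grayInv (charSeq (cycCl p γ 4 1 ∪ cycCl p γ 4 2) t)
        (charSeq (cycCl p γ 4 2 ∪ cycCl p γ 4 3 ∪ {0}) t)).val =
      χ t + if t = 0 then Complex.I else 0 := by
  have h0 := ne_zero_of_orderOf_eq hγ
  by_cases ht : t = 0
  · subst ht
    rw [charSeq_eq_zero (by simp [zero_notMem_cycCl h0]), charSeq_eq_one (by simp)]
    simp [grayInv, show (1 : ZMod 4).val = 1 from rfl, MulChar.map_zero]
  · obtain ⟨n, hn, rfl⟩ := exists_pow_eq hγ ht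
    have hm k (hk : k < 4) := pow_mem_cycCl_iff (k := k) hγ hp hn hk
    rw [if_neg ht, add_zero, map_pow, hχ, neg_I_pow]
    have h4 : n % 4 < 4 := Nat.mod_lt _ (by norm_num)
    simp only [charSeq, Set.mem_union, Set.mem_singleton_iff, ht, or_false, hm 1 (by norm_num),
      hm 2 (by norm_num), hm 3 (by norm_num)]
    generalize n % 4 = r at h4
    interval_cases r <;>
      simp [grayInv, pow_succ, show (1 : ZMod 4).val = 1 from rfl,
        show (2 : ZMod 4).val = 2 from rfl, show (3 : ZMod 4).val = 3 from rfl]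

theorem quatAC_eq {p : ℕ} [Fact p.Prime] (hp : p % 8 = 1)
    {γ : ZMod p} (hγ : orderOf γ = p - 1) {u : ZMod p → ZMod 4}
    (hu : ∀ t, u t = grayInv (charSeq (cycCl p γ 4 1 ∪ cycCl p γ 4 2) t)
        (charSeq (cycCl p γ 4 2 ∪ cycCl p γ 4 3 ∪ {0}) t))
    (n : ℕ) :
    quatAC u (γ ^ n) = if n % 4 = 1 then -3 else if n % 4 = 3 then 1 else -1 := by
  obtain ⟨χ, hχ⟩ := exists_mulChar hp hγ
  have h0 := ne_zero_of_orderOf_eq hγ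
  set τ := γ ^ n with hτ
  have hτ0 : τ ≠ 0 := pow_ne_zero _ h0
  have hχ1 : χ ≠ 1 := by
    rintro rfl
    rw [MulChar.one_apply h0.isUnit] at hχ
    simpa using congrArg Complex.re hχ
  have hneg : χ (-1) = 1 := by
    obtain ⟨k, hk, hk'⟩ := exists_pow_eq hγ (t := -1) (by simp)
    have h2 : γ ^ (2 * k) = 1 := by rw [mul_comm, pow_mul, ← hk']; norm_num
    have h3 := orderOf_dvd_of_pow_eq_one h2
    rw [hγ] at h3
    rw [hk', map_pow, hχ, neg_I_pow]
    have : 8 ∣ 2 * k := dvd_trans (by omega) h3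
    rw [show k % 4 = 0 by omega, pow_zero]
  have hstar t : (starRingEnd ℂ) (χ t) = χ⁻¹ t := by
    rw [← MulChar.star_eq_inv, MulChar.star_apply, starRingEnd_apply]
  have hterm t : Complex.I ^ (u t - u (t + τ)).val = χ t * χ⁻¹ (t + τ) +
      (if t = 0 then Complex.I * χ⁻¹ τ else 0) - (if t = -τ then Complex.I * χ τ else 0) := by
    rw [I_pow_val_sub, hu, hu, I_pow_grayInv hp hγ hχ, I_pow_grayInv hp hγ hχ, map_add, hstar]
    simp only [add_eq_zero_iff_eq_neg]
    by_cases h1 : t = 0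
    · subst h1
      simp [hτ0, eq_comm, add_mul]
    · by_cases h2 : t = -τ
      · subst h2
        have : χ (-τ) = χ τ := by rw [neg_eq_neg_one_mul, map_mul, hneg, one_mul]
        simp [hτ0, this]
        ring
      · simp [h1, h2]
  rw [quatAC, Finset.sum_congr rfl (fun t _ => hterm t), Finset.sum_sub_distrib,
    Finset.sum_add_distrib, sum_mulChar_mul_inv_add hχ1 hτ0, Finset.sum_ite_eq',
    Finset.sum_ite_eq', if_pos (Finset.mem_univ _), if_pos (Finset.mem_univ _), ← hstar, hτ,
    map_pow, hχ, neg_I_pow]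
  have h4 : n % 4 < 4 := Nat.mod_lt _ (by norm_num)
  generalize n % 4 = r at h4
  interval_cases r <;> (simp [Complex.ext_iff, pow_succ]; try norm_num)

theorem stmt4 (p : ℕ) [Fact p.Prime] (hp : p % 8 = 1)
    (γ : ZMod p) (hγ : orderOf γ = p - 1)
    (u : ZMod p → ZMod 4)
    (hu : ∀ t, u t = grayInv (charSeq (cycCl p γ 4 1 ∪ cycCl p γ 4 2) t)
        (charSeq (cycCl p γ 4 2 ∪ cycCl p γ 4 3 ∪ {0}) t)) :
    quatAC u 0 = (p : ℂ) ∧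
      {τ : ZMod p | τ ≠ 0 ∧ quatAC u τ = -1}.ncard = (p - 1) / 2 ∧
      {τ : ZMod p | τ ≠ 0 ∧ quatAC u τ = 1}.ncard = (p - 1) / 4 ∧
      {τ : ZMod p | τ ≠ 0 ∧ quatAC u τ = -3}.ncard = (p - 1) / 4 := by
  have h0 := ne_zero_of_orderOf_eq hγ
  have key (v : ℂ) (a b m : ℕ) (hb : 0 < b) (hlt : ∀ j < m, a + b * j < p - 1)
      (hv : ∀ n < p - 1, (if n % 4 = 1 then (-3 : ℂ) else if n % 4 = 3 then 1 else -1) = v ↔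
        ∃ j < m, n = a + b * j) :
      {τ : ZMod p | τ ≠ 0 ∧ quatAC u τ = v}.ncard = m := by
    rw [← ncard_pow_progression hγ hb hlt]
    congr 1
    ext τ
    constructor
    · rintro ⟨hτ, h⟩
      obtain ⟨n, hn, rfl⟩ := exists_pow_eq hγ hτ
      rw [quatAC_eq hp hγ hu, hv n hn] at h
      obtain ⟨j, hj, rfl⟩ := h
      exact ⟨j, hj, rfl⟩
    · rintro ⟨j, hj, rfl⟩
      refine ⟨pow_ne_zero _ h0, ?_⟩
      rw [quatAC_eq hp hγ hu, hv _ (hlt j hj)]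
      exact ⟨j, hj, rfl⟩
  refine ⟨by simp [quatAC], key _ 0 2 _ (by norm_num) (by omega) ?_,
    key _ 3 4 _ (by norm_num) (by omega) ?_, key _ 1 4 _ (by norm_num) (by omega) ?_⟩
  · intro n hn
    split_ifs with h1 h3
    · exact iff_of_false (by norm_num) (by rintro ⟨j, -, rfl⟩; omega)
    · exact iff_of_false (by norm_num) (by rintro ⟨j, -, rfl⟩; omega)
    · exact iff_of_true rfl ⟨n / 2, by omega, by omega⟩
  · intro n hn
    split_ifs with h1 h3
    · exact iff_of_false (by norm_num) (by rintro ⟨j, -, rfl⟩; omega)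
    · exact iff_of_true rfl ⟨n / 4, by omega, by omega⟩
    · exact iff_of_false (by norm_num) (by rintro ⟨j, -, rfl⟩; omega)
  · intro n hn
    split_ifs with h1 h3
    · exact iff_of_true rfl ⟨n / 4, by omega, by omega⟩
    · exact iff_of_false (by norm_num) (by rintro ⟨j, -, rfl⟩; omega)
    · exact iff_of_false (by norm_num) (by rintro ⟨j, -, rfl⟩; omega)
end
end

section
/- Let N be an even positive integer and s₀ : ℤ/Nℤ → ℤ/2ℤ an almost balanced binary sequence of period N whose out-of-phase autocorrelation is optimal, i.e. for all τ ≢ 0 (mod N): R_{s₀}(τ) ∈ {0, −4} if N ≡ 0 (mod 4), and R_{s₀}(τ) ∈ {−2, 2} if N ≡ 2 (mod 4). Let c ∈ ℤ/2ℤ and define the quaternary sequence u : ℤ/Nℤ → ℤ/4ℤ by u(t) = φ⁻¹(s₀(t), s₀(t + N/2) + c). If N ≡ 2, 4 or 6 (mod 8), then u is almost balanced. -/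
open scoped Classical

noncomputable section

/-- The number of `t` at which the sequence takes the value `a` and its shift by `h` the
value `b`. -/
def pairCount {N : ℕ} [NeZero N] (s : ZMod N → ZMod 2) (h : ZMod N) (a b : ZMod 2) : ℕ :=
  (Finset.univ.filter fun t => s t = a ∧ s (t + h) = b).card

lemma cnt_eq_card {N m : ℕ} [NeZero N] (u : ZMod N → ZMod m) (k : ZMod m) :
    cnt u k = (Finset.univ.filter fun t => u t = k).card := by
  rw [cnt, ← Set.ncard_coe_finset]
  simp

lemma pairCount_swap {N : ℕ} [NeZero N] (s : ZMod N → ZMod 2) {h : ZMod N} (hh : h + h = 0)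
    (a b : ZMod 2) : pairCount s h a b = pairCount s h b a := by
  have key (t : ZMod N) : t + h + h = t := by rw [add_assoc, hh, add_zero]
  refine Finset.card_nbij' (· + h) (· + h) ?_ ?_ ?_ ?_ <;> intro t <;> simp [key] <;> tauto

lemma even_pairCount_self {N : ℕ} [NeZero N] (s : ZMod N → ZMod 2) {h : ZMod N}
    (hh : h + h = 0) (h0 : h ≠ 0) (a : ZMod 2) : Even (pairCount s h a a) := by
  have key (t : ZMod N) : t + h + h = t := by rw [add_assoc, hh, add_zero]
  rw [← ZMod.natCast_eq_zero_iff_even, pairCount, Finset.cast_card]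
  refine Finset.sum_involution (fun t _ => t + h) ?_ ?_ ?_ ?_
  · intro t _
    decide
  · intro t _ _
    simpa using h0
  · intro t
    simp only [Finset.mem_filter, Finset.mem_univ, true_and, key]
    tauto
  · intro t _
    exact key t

lemma cnt_eq_pairCount_add {N : ℕ} [NeZero N] (s : ZMod N → ZMod 2) (h : ZMod N)
    (a : ZMod 2) : cnt s a = pairCount s h a 0 + pairCount s h a 1 := by
  simp only [cnt_eq_card, pairCount, Finset.card_filter, ← Finset.sum_add_distrib]
  refine Finset.sum_congr rfl fun t _ => ?_
  generalize s t = x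
  generalize s (t + h) = y
  revert x y a
  decide

lemma cnt_zero_add_cnt_one {N : ℕ} [NeZero N] (s : ZMod N → ZMod 2) :
    cnt s 0 + cnt s 1 = N := by
  simp only [cnt_eq_card, Finset.card_filter, ← Finset.sum_add_distrib]
  have key : ∀ x : ZMod 2, ((if x = 0 then 1 else 0) + if x = 1 then 1 else 0) = 1 := by decide
  simp [key]

lemma binCC_self_eq {N : ℕ} [NeZero N] (s : ZMod N → ZMod 2) (h : ZMod N) :
    binCC s s h = pairCount s h 0 0 + pairCount s h 1 1
      - pairCount s h 0 1 - pairCount s h 1 0 := by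
  simp only [binCC, pairCount, Finset.card_filter, Nat.cast_sum, ← Finset.sum_add_distrib,
    ← Finset.sum_sub_distrib]
  refine Finset.sum_congr rfl fun t _ => ?_
  generalize s t = x
  generalize s (t + h) = y
  revert x y
  decide

lemma grayInv_eq_iff (a b x y : ZMod 2) : grayInv a b = grayInv x y ↔ a = x ∧ b = y := by
  unfold grayInv
  revert a b x y
  decide

/-- The counts of a sequence of Gray-map images are the pair counts of its components. -/
lemma cnt_grayInv {N : ℕ} [NeZero N] {s : ZMod N → ZMod 2} {h : ZMod N} {c : ZMod 2}
    {u : ZMod N → ZMod 4} (hu : ∀ t, u t = grayInv (s t) (s (t + h) + c)) (x y : ZMod 2) :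
    cnt u (grayInv x y) = pairCount s h x (y - c) := by
  rw [cnt_eq_card, pairCount]
  simp only [hu, grayInv_eq_iff, eq_sub_iff_add_eq]

lemma exists_grayInv_eq (k : ZMod 4) : ∃ x y, grayInv x y = k := by
  unfold grayInv
  revert k
  decide

theorem stmt13 (N : ℕ) [NeZero N] (hN : 2 ∣ N)
    (s₀ : ZMod N → ZMod 2)
    (hbal : ∀ k₁ k₂ : ZMod 2, cnt s₀ k₁ ≤ cnt s₀ k₂ + 2)
    (hopt0 : N % 4 = 0 → ∀ τ : ZMod N, τ ≠ 0 →
      binCC s₀ s₀ τ = 0 ∨ binCC s₀ s₀ τ = -4)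
    (hopt2 : N % 4 = 2 → ∀ τ : ZMod N, τ ≠ 0 →
      binCC s₀ s₀ τ = -2 ∨ binCC s₀ s₀ τ = 2)
    (c : ZMod 2)
    (u : ZMod N → ZMod 4)
    (hu : ∀ t, u t = grayInv (s₀ t) (s₀ (t + ((N / 2 : ℕ) : ZMod N)) + c))
    (hN8 : N % 8 = 2 ∨ N % 8 = 4 ∨ N % 8 = 6) :
    ∀ k₁ k₂ : ZMod 4, cnt u k₁ ≤ cnt u k₂ + 2 := by
  obtain ⟨m, rfl⟩ := hN
  have hm : 0 < m := by omega
  rw [Nat.mul_div_cancel_left m two_pos] at hu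
  set h : ZMod (2 * m) := (m : ZMod (2 * m)) with hdef
  have hh : h + h = 0 := by
    rw [hdef, ← Nat.cast_add, ← two_mul, ZMod.natCast_self]
  have h0 : h ≠ 0 := by
    rw [hdef, Ne, ZMod.natCast_eq_zero_iff]
    intro hd
    have := Nat.le_of_dvd hm hd
    omega
  have hR := binCC_self_eq s₀ h
  have hsw := pairCount_swap s₀ hh 0 1
  obtain ⟨i, hi⟩ := even_pairCount_self s₀ hh h0 0
  obtain ⟨j, hj⟩ := even_pairCount_self s₀ hh h0 1
  have hc0 := cnt_eq_pairCount_add s₀ h 0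
  have hc1 := cnt_eq_pairCount_add s₀ h 1
  have hc := cnt_zero_add_cnt_one s₀
  have hb01 := hbal 0 1
  have hb10 := hbal 1 0
  have hR0 := fun hmod => hopt0 hmod h h0
  have hR2 := fun hmod => hopt2 hmod h h0
  have main : ∀ a b a' b' : ZMod 2, pairCount s₀ h a b ≤ pairCount s₀ h a' b' + 2 := by
    have cases01 : ∀ x : ZMod 2, x = 0 ∨ x = 1 := by decide
    intro a b a' b'
    rcases cases01 a with rfl | rfl <;> rcases cases01 b with rfl | rfl <;>
      rcases cases01 a' with rfl | rfl <;> rcases cases01 b' with rfl | rfl <;> omega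
  intro k₁ k₂
  obtain ⟨x, y, rfl⟩ := exists_grayInv_eq k₁
  obtain ⟨x', y', rfl⟩ := exists_grayInv_eq k₂
  rw [cnt_grayInv hu, cnt_grayInv hu]
  exact main ..
end
end

section
/- Let N be an even positive integer and s : ℤ/Nℤ → ℤ/2ℤ a binary sequence of period N, regarded as a sequence over F₄ via the inclusion F₂ ⊆ F₄, and suppose that (X − 1)² divides the minimal polynomial P_s(X) in F₄[X]. Define v : ℤ/Nℤ → F₄ by v(t) = μ·s(t) + s(t + N/2) + 1 (the second Gray coordinate is the complemented sequence shifted by N/2). Then gcd(X^N − 1, v(X)) = gcd(X^N − 1, s(X)) in F₄[X]; consequently P_v(X) = P_s(X) and L(v) = L(s). -/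
open scoped Classical

noncomputable section

/-- The sequence polynomial `v(X) = Σ_{t=0}^{N-1} v(t) X^t` of a sequence `v : ℤ/N → F`. -/
def seqPoly {N : ℕ} {F : Type*} [Semiring F] (v : ZMod N → F) : Polynomial F :=
  ∑ t ∈ Finset.range N, Polynomial.C (v (t : ZMod N)) * Polynomial.X ^ t

/-- The minimal polynomial `P_v(X) = (X^N - 1) / gcd(X^N - 1, v(X))` of a sequence over a
field (the gcd being taken monic). -/
def minPol {N : ℕ} {F : Type*} [Field F] (v : ZMod N → F) : Polynomial F :=
  (Polynomial.X ^ N - 1) / gcd (Polynomial.X ^ N - 1) (seqPoly v)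

/-- The linear complexity `L(v) = N - deg gcd(X^N - 1, v(X))` of a sequence over a field
(the gcd being taken monic). -/
def linCpx {N : ℕ} {F : Type*} [Field F] (v : ZMod N → F) : ℕ :=
  N - (gcd (Polynomial.X ^ N - 1) (seqPoly v)).natDegree

/-- The inclusion `F₂ ⊆ F` sending `0 ↦ 0`, `1 ↦ 1`. -/
def binToF {F : Type*} [Field F] (x : ZMod 2) : F :=
  if x = 1 then 1 else 0

/-- If `d = gcd f s` and the cofactors `f / d` and `w / d` are coprime, then `gcd f w = d`. -/
theorem gcd_eq_gcd_of_isCoprime_cofactors {R : Type*} [CommRing R] [NormalizedGCDMonoid R]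
    {f s w P b : R} (hf : f = gcd f s * P) (hw : w = gcd f s * b) (h : IsCoprime P b) :
    gcd f w = gcd f s := by
  obtain ⟨x, y, hxy⟩ := h
  refine dvd_antisymm_of_normalize_eq (normalize_gcd _ _) (normalize_gcd _ _) ?_
    (dvd_gcd (gcd_dvd_left _ _) ⟨b, hw⟩)
  have key : gcd f s = x * f + y * w := by
    linear_combination (-gcd f s) * hxy - x * hf - y * hw
  rw [key]
  exact dvd_add ((gcd_dvd_left f w).mul_left x) ((gcd_dvd_right f w).mul_left y)

/-- Shifting a sequence of period `2 * M` by `M` multiplies its sequence polynomial by `X ^ M`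
modulo `X ^ (2 * M) - 1`. -/
theorem exists_seqPoly_shift_eq {R : Type*} [CommRing R] (M : ℕ) (a : ZMod (2 * M) → R) :
    ∃ B : Polynomial R, seqPoly (fun t => a (t + (M : ZMod (2 * M)))) =
      Polynomial.X ^ M * seqPoly a + (Polynomial.X ^ (2 * M) - 1) * B := by
  have hM : (M : ZMod (2 * M)) + M = 0 := by
    rw [← Nat.cast_add, ← two_mul, ZMod.natCast_self]
  have split (g : ZMod (2 * M) → R) : seqPoly g =
      ∑ t ∈ Finset.range M, Polynomial.C (g t) * Polynomial.X ^ t +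
        Polynomial.X ^ M *
          ∑ t ∈ Finset.range M, Polynomial.C (g (t + (M : ZMod (2 * M)))) * Polynomial.X ^ t := by
    have hr : Finset.range (2 * M) = Finset.range (M + M) := by rw [two_mul]
    rw [seqPoly, hr, Finset.sum_range_add, Finset.mul_sum]
    congr 1
    refine Finset.sum_congr rfl fun t _ => ?_
    rw [add_comm M t, Nat.cast_add, pow_add]
    ring
  refine ⟨-∑ t ∈ Finset.range M, Polynomial.C (a (t + (M : ZMod (2 * M)))) * Polynomial.X ^ t, ?_⟩
  rw [split a, split]
  simp only [add_assoc, hM, add_zero]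
  ring

/-- The sequence polynomial is affine in the sequence. -/
theorem seqPoly_mul_add_add_one {R : Type*} [CommRing R] {N : ℕ} (c : R) (a b : ZMod N → R) :
    seqPoly (fun t => c * a t + b t + 1) =
      Polynomial.C c * seqPoly a + seqPoly b + ∑ t ∈ Finset.range N, Polynomial.X ^ t := by
  simp only [seqPoly, Finset.mul_sum, ← Finset.sum_add_distrib]
  refine Finset.sum_congr rfl fun t _ => ?_
  simp only [map_add, map_mul, map_one]
  ring

/-- In characteristic two, `X ^ (2 * M) - 1` is coprime to `c + X ^ M` whenever `c ≠ 1`. -/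
theorem isCoprime_X_pow_sub_one_C_add_X_pow {F : Type*} [Field F] (h2 : (2 : F) = 0) (M : ℕ)
    {c : F} (hc : c + 1 ≠ 0) :
    IsCoprime (Polynomial.X ^ (2 * M) - 1 : Polynomial F)
      (Polynomial.C c + Polynomial.X ^ M) := by
  have h2' : (2 : Polynomial F) = 0 := by
    rw [← map_ofNat Polynomial.C 2, h2, map_zero]
  have hsq : (Polynomial.X ^ (2 * M) - 1 : Polynomial F) = (Polynomial.X ^ M - 1) ^ 2 := by
    linear_combination (Polynomial.X ^ M - 1) * h2'
  have hinv : (Polynomial.C (c + 1)⁻¹ * Polynomial.C (c + 1) : Polynomial F) = 1 := by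
    rw [← map_mul, inv_mul_cancel₀ hc, map_one]
  rw [map_add, map_one] at hinv
  rw [hsq]
  refine IsCoprime.pow_left ⟨-Polynomial.C (c + 1)⁻¹, Polynomial.C (c + 1)⁻¹, ?_⟩
  linear_combination hinv

theorem stmt15 (N : ℕ) [NeZero N] (hN : 2 ∣ N)
    (F : Type*) [Field F] [Fintype F] (hF : Fintype.card F = 4)
    (μ : F) (hμ : μ ^ 2 + μ + 1 = 0)
    (s : ZMod N → ZMod 2)
    (hdvd : (Polynomial.X - 1) ^ 2 ∣ minPol (fun t => (binToF (s t) : F)))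
    (v : ZMod N → F)
    (hv : ∀ t, v t = μ * binToF (s t) + binToF (s (t + ((N / 2 : ℕ) : ZMod N))) + 1) :
    gcd (Polynomial.X ^ N - 1) (seqPoly v) =
        gcd (Polynomial.X ^ N - 1) (seqPoly (fun t => (binToF (s t) : F))) ∧
      minPol v = minPol (fun t => (binToF (s t) : F)) ∧
      linCpx v = linCpx (fun t => (binToF (s t) : F)) := by
  have h2 : (2 : F) = 0 := by
    have h4 : ((4 : ℕ) : F) = 0 := hF ▸ Nat.cast_card_eq_zero F
    have h : (2 : F) * 2 = 0 := by push_cast at h4; linear_combination h4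
    exact (mul_self_eq_zero).1 h
  have hc : μ + 1 ≠ 0 := by
    intro h
    have : (1 : F) = 0 := by linear_combination hμ - μ * h
    exact one_ne_zero this
  have hN0 : N ≠ 0 := NeZero.ne N
  suffices h : gcd (Polynomial.X ^ N - 1) (seqPoly v) =
      gcd (Polynomial.X ^ N - 1) (seqPoly (fun t => (binToF (s t) : F))) by
    exact ⟨h, by rw [minPol, minPol, h], by rw [linCpx, linCpx, h]⟩
  obtain ⟨M, rfl⟩ := hN
  rw [Nat.mul_div_cancel_left M two_pos] at hv
  obtain ⟨B, hB⟩ := exists_seqPoly_shift_eq M (fun t => (binToF (s t) : F))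
  have hvS := seqPoly_mul_add_add_one μ (fun t => (binToF (s t) : F))
    (fun t => binToF (s (t + (M : ZMod (2 * M)))))
  rw [← funext hv, hB] at hvS
  have hu := isCoprime_X_pow_sub_one_C_add_X_pow h2 M hc
  have hE := geom_sum_mul (Polynomial.X : Polynomial F) (2 * M)
  have hf0 : (Polynomial.X ^ (2 * M) - 1 : Polynomial F) ≠ 0 :=
    (Polynomial.monic_X_pow_sub_C (1 : F) hN0).ne_zero
  rw [minPol] at hdvd
  generalize seqPoly (fun t => (binToF (s t) : F)) = S at *
  generalize seqPoly v = w at *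
  generalize (∑ t ∈ Finset.range (2 * M), (Polynomial.X : Polynomial F) ^ t) = E at *
  generalize (Polynomial.X ^ (2 * M) - 1 : Polynomial F) = f at *
  have hG0 : gcd f S ≠ 0 := fun h => hf0 ((gcd_eq_zero_iff _ _).1 h).1
  have hfP : f = gcd f S * (f / gcd f S) :=
    (EuclideanDomain.mul_div_cancel' hG0 (gcd_dvd_left _ _)).symm
  have hSa : S = gcd f S * (S / gcd f S) :=
    (EuclideanDomain.mul_div_cancel' hG0 (gcd_dvd_right _ _)).symm
  have hPa : IsCoprime (f / gcd f S) (S / gcd f S) := isCoprime_div_gcd_div_gcd_of_gcd_ne_zero hG0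
  generalize f / gcd f S = P at *
  generalize S / gcd f S = a at *
  obtain ⟨c, rfl⟩ := hdvd
  have hX : (Polynomial.X - 1 : Polynomial F) ≠ 0 := Polynomial.X_sub_C_ne_zero 1
  have hEG : E = gcd f S * ((Polynomial.X - 1) * c) := by
    apply mul_right_cancel₀ hX
    linear_combination hE + hfP
  have hPu := (hu.of_isCoprime_of_dvd_left (Dvd.intro_left _ hfP.symm)).mul_right hPa
  refine gcd_eq_gcd_of_isCoprime_cofactors hfP
    (b := (Polynomial.C μ + Polynomial.X ^ M) * a +
      (Polynomial.X - 1) * c * (1 + (Polynomial.X - 1) * B)) ?_ ?_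
  · linear_combination hvS + (Polynomial.C μ + Polynomial.X ^ M) * hSa + hEG + B * hfP
  · have h1 : IsCoprime ((Polynomial.X - 1) * c) ((Polynomial.C μ + Polynomial.X ^ M) * a) :=
      hPu.of_isCoprime_of_dvd_left ⟨Polynomial.X - 1, by ring⟩
    exact ((h1.add_mul_left_right _).pow_left (m := 2)).of_isCoprime_of_dvd_left ⟨c, by ring⟩
end
end

section
/- Let N be a positive integer, let s₁, s₂ : ℤ/Nℤ → ℤ/2ℤ be binary sequences of period N, and define the quaternary sequence u : ℤ/Nℤ → ℤ/4ℤ by u(t) = φ⁻¹(s₁(t), s₂(t)). Then for every shift τ ∈ ℤ/Nℤ, R_u(τ) = (1/2)[R_{s₁}(τ) + R_{s₂}(τ)] + (i/2)[R_{s₁,s₂}(τ) − R_{s₂,s₁}(τ)], where i = √(−1). -/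
open scoped Classical

noncomputable section

/-- Pointwise form of the correlation identity for the inverse Gray map. -/
theorem I_pow_grayInv_sub (a b c d : ZMod 2) :
    Complex.I ^ (grayInv a b - grayInv c d).val =
      (1 / 2 : ℂ) * ((-1) ^ (a - c).val + (-1) ^ (b - d).val) +
        (Complex.I / 2) * ((-1) ^ (a - d).val - (-1) ^ (b - c).val) := by
  have cases_two : ∀ x : ZMod 2, x = 0 ∨ x = 1 := by decide
  have val_one : (1 : ZMod 2).val = 1 := rfl
  have val_neg_one : (-1 : ZMod 2).val = 1 := rfl
  have h₁ : (1 : ZMod 4).val = 1 := rfl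
  have h₂ : (2 : ZMod 4).val = 2 := rfl
  have h₃ : (3 : ZMod 4).val = 3 := rfl
  have h₀₁ : (-1 : ZMod 4) = 3 := rfl
  have h₀₂ : (-2 : ZMod 4) = 2 := rfl
  have h₀₃ : (-3 : ZMod 4) = 1 := rfl
  have h₁₂ : (1 - 2 : ZMod 4) = 3 := rfl
  have h₁₃ : (1 - 3 : ZMod 4) = 2 := rfl
  have h₂₁ : (2 - 1 : ZMod 4) = 1 := rfl
  have h₂₃ : (2 - 3 : ZMod 4) = 3 := rfl
  have h₃₁ : (3 - 1 : ZMod 4) = 2 := rfl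
  have h₃₂ : (3 - 2 : ZMod 4) = 1 := rfl
  rcases cases_two a with rfl | rfl <;> rcases cases_two b with rfl | rfl <;>
    rcases cases_two c with rfl | rfl <;> rcases cases_two d with rfl | rfl <;>
    simp only [grayInv, if_true, one_ne_zero, if_false, sub_self, sub_zero, zero_sub,
      ZMod.val_zero, val_one, val_neg_one, h₁, h₂, h₃, h₀₁, h₀₂, h₀₃, h₁₂, h₁₃, h₂₁, h₂₃,
      h₃₁, h₃₂, Complex.I_sq, Complex.I_pow_three, pow_zero, pow_one] <;>
    ring

theorem stmt18 (N : ℕ) [NeZero N]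
    (s₁ s₂ : ZMod N → ZMod 2)
    (u : ZMod N → ZMod 4)
    (hu : ∀ t, u t = grayInv (s₁ t) (s₂ t)) :
    ∀ τ : ZMod N,
      quatAC u τ =
        (1 / 2 : ℂ) * ((binCC s₁ s₁ τ : ℂ) + (binCC s₂ s₂ τ : ℂ)) +
          (Complex.I / 2) * ((binCC s₁ s₂ τ : ℂ) - (binCC s₂ s₁ τ : ℂ)) := by
  intro τ
  simp only [quatAC, binCC, hu, I_pow_grayInv_sub]
  push_cast
  simp only [Finset.sum_add_distrib, Finset.sum_sub_distrib, ← Finset.mul_sum]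
end
end
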